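/- For every positive integer n, the number of pairs (a, j) with a a nonnegative integer and j an integer such that G_a + 3j² = n (so that each positive value 3j² is counted once for j and once for −j) is odd if and only if n is a generalized pentagonal number, i.e. n = G_m for some integer m ≥ 0. -/

import Mathlib

/-- The `n`-th triangular number `T n = n(n+1)/2`. -/
def T (n : ℕ) : ℕ := n * (n + 1) / 2

/-- The `n`-th generalized pentagonal number `G n = T n - T ⌊n/2⌋`. -/
def G (n : ℕ) : ℕ := T n - T (n / 2)

theorem T_succ (n : ℕ) : T (n + 1) = T n + (n + 1) := by
  unfold T
  rw [show (n + 1) * (n + 1 + 1) = n * (n + 1) + (n + 1) * 2 by ring,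
    Nat.add_mul_div_right _ _ two_pos]

theorem T_mono : Monotone T :=
  monotone_nat_of_le_succ fun n => by rw [T_succ]; omega

theorem G_strictMono : StrictMono G := by
  refine strictMono_nat_of_lt_succ fun n => ?_
  have hle : T (n / 2) ≤ T n := T_mono (Nat.div_le_self n 2)
  unfold G
  rw [T_succ]
  obtain h | h : (n + 1) / 2 = n / 2 ∨ (n + 1) / 2 = n / 2 + 1 := by omega
  · rw [h]
    omega
  · rw [h, T_succ]
    omega

/-- The representations of `n` as a generalized pentagonal number plus three times a square. -/
abbrev PentagonalRep (n : ℕ) : Type :=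
  {p : ℕ × ℤ // (G p.1 : ℤ) + 3 * p.2 ^ 2 = (n : ℤ)}

instance PentagonalRep.finite (n : ℕ) : Finite (PentagonalRep n) := by
  refine Set.Finite.to_subtype
    (((Set.finite_Iic n).prod (Set.finite_Icc (-(n : ℤ)) n)).subset ?_)
  rintro ⟨a, j⟩ (h : (G a : ℤ) + 3 * j ^ 2 = n)
  have ha : a ≤ G a := G_strictMono.le_apply
  simp only [Set.mem_prod, Set.mem_Iic, Set.mem_Icc]
  refine ⟨by zify at ha ⊢; nlinarith [sq_nonneg j], ?_, ?_⟩
  · nlinarith [Int.le_self_sq (-j), sq_nonneg j]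
  · nlinarith [Int.le_self_sq j, sq_nonneg j]

/-- The involution `(a, j) ↦ (a, -j)` on representations. -/
def PentagonalRep.neg (n : ℕ) : PentagonalRep n → PentagonalRep n :=
  fun p => ⟨(p.1.1, -p.1.2), by simpa using p.2⟩

theorem PentagonalRep.mem_fixedPoints_neg {n : ℕ} {p : PentagonalRep n} :
    p ∈ Function.fixedPoints (PentagonalRep.neg n) ↔ p.1.2 = 0 := by
  rw [Function.mem_fixedPoints, Function.IsFixedPt, Subtype.ext_iff, Prod.ext_iff]
  simp only [PentagonalRep.neg, true_and]
  omega

theorem PentagonalRep.card_modEq_card_fixedPoints_neg (n : ℕ) :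
    Nat.card (PentagonalRep n) ≡
      Nat.card (Function.fixedPoints (PentagonalRep.neg n)) [MOD 2] := by
  classical
  have := Fintype.ofFinite (PentagonalRep n)
  let f : Function.End (PentagonalRep n) := PentagonalRep.neg n
  have hf : f ^ 2 ^ 1 = 1 := by
    rw [pow_one, pow_two]
    funext p
    exact Subtype.ext (Prod.ext rfl (neg_neg p.1.2))
  have hcard := Equiv.Perm.card_fixedPoints_modEq hf
  rwa [← Nat.card_eq_fintype_card, ← Nat.card_eq_fintype_card] at hcard

instance PentagonalRep.subsingleton_fixedPoints_neg (n : ℕ) :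
    Subsingleton (Function.fixedPoints (PentagonalRep.neg n)) := by
  refine ⟨fun ⟨⟨⟨a, j⟩, hp⟩, hj⟩ ⟨⟨⟨b, k⟩, hq⟩, hk⟩ => ?_⟩
  obtain rfl : j = 0 := mem_fixedPoints_neg.1 hj
  obtain rfl : k = 0 := mem_fixedPoints_neg.1 hk
  obtain rfl : a = b := G_strictMono.injective (by simp at hp hq; omega)
  rfl

theorem PentagonalRep.nonempty_fixedPoints_neg_iff (n : ℕ) :
    Nonempty (Function.fixedPoints (PentagonalRep.neg n)) ↔ ∃ m, n = G m := by
  constructor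
  · rintro ⟨⟨⟨⟨a, j⟩, hp⟩, hj⟩⟩
    obtain rfl : j = 0 := mem_fixedPoints_neg.1 hj
    exact ⟨a, by simp at hp; omega⟩
  · rintro ⟨m, rfl⟩
    exact ⟨⟨⟨(m, 0), by simp⟩, mem_fixedPoints_neg.2 rfl⟩⟩

theorem stmt_11 (n : ℕ) (hn : 0 < n) :
    Odd (Nat.card {p : ℕ × ℤ // (G p.1 : ℤ) + 3 * p.2 ^ 2 = (n : ℤ)}) ↔ ∃ m, n = G m := by
  rw [Nat.odd_iff, PentagonalRep.card_modEq_card_fixedPoints_neg n,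
    ← PentagonalRep.nonempty_fixedPoints_neg_iff]
  have hle := Finite.card_le_one_iff_subsingleton.2
    (PentagonalRep.subsingleton_fixedPoints_neg n)
  rw [← Finite.card_pos_iff]
  omega
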